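/- Let s ≡ 3 (mod 4) be square-free with s ≥ 19 and 3 ∤ s, and K = Q(√6, √s). Then α = 1² + 1² + 1² + (1+√6)² + ((√6+√(6s))/2)² + (1+(√6+√(6s))/2)² has length exactly 6 in the ring of integers O_K, and its unique representation as a sum of squares (up to order and sign) is (1+(√6+√(6s))/2)² + ((√6+√(6s))/2)² + (1+√6)² + 1² + 1² + 1². -/

import Mathlib

open scoped Classical

noncomputable section

/-- `α` is a sum of `n` squares of elements of `S ⊆ ℝ`. -/
def SumOfSquaresLen (S : Set ℝ) (n : ℕ) (α : ℝ) : Prop :=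
  ∃ x : Fin n → ℝ, (∀ i, x i ∈ S) ∧ α = ∑ i, x i ^ 2

/-- The length of `α` as a sum of squares of elements of `S` (∞ if not a sum of squares). -/
def sqLength (S : Set ℝ) (α : ℝ) : ℕ∞ :=
  sInf {n : ℕ∞ | ∃ k : ℕ, n = (k : ℕ∞) ∧ SumOfSquaresLen S k α}

/-- The Pythagoras number of `S ⊆ ℝ`. -/
def pythagorasNumber (S : Set ℝ) : ℕ∞ :=
  sSup {n : ℕ∞ | ∃ α : ℝ, (∃ k : ℕ, SumOfSquaresLen S k α) ∧ n = sqLength S α}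

/-- The biquadratic field `ℚ(√p, √q)` as a subfield of `ℝ`. -/
def biquadField (p q : ℝ) : IntermediateField ℚ ℝ :=
  IntermediateField.adjoin ℚ {Real.sqrt p, Real.sqrt q}

/-- The ring of integers of `ℚ(√p, √q)`, viewed as a subset of `ℝ`. -/
def ringOfInt (p q : ℝ) : Set ℝ :=
  {x : ℝ | x ∈ biquadField p q ∧ IsIntegral ℤ x}

theorem pick_one {n : ℕ} (T : Finset (Fin n)) (f : Fin n → ℤ) (k : ℤ) (hk0 : 0 ≤ k) (hk : k < 3)
    (h : ∑ i ∈ T, f i ^ 2 = k + 1) :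
    ∃ i ∈ T, f i ^ 2 = 1 ∧ ∑ j ∈ T.erase i, f j ^ 2 = k := by
  have hne : ∃ i ∈ T, f i ^ 2 ≠ 0 := by
    by_contra! hc
    rw [Finset.sum_eq_zero hc] at h
    omega
  obtain ⟨i, hi, hf⟩ := hne
  have h2 := Finset.add_sum_erase T (fun j => f j ^ 2) hi
  have h3 : 0 ≤ ∑ j ∈ T.erase i, f j ^ 2 := Finset.sum_nonneg fun j _ => sq_nonneg _
  have h4 : f i ^ 2 = 1 ∨ 4 ≤ f i ^ 2 := by
    have : f i ≠ 0 := by rintro h0; simp [h0] at hf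
    rcases lt_or_gt_of_ne this with h5 | h5
    · by_cases h6 : f i = -1
      · left; rw [h6]; norm_num
      · right; have : f i ≤ -2 := by omega
        nlinarith
    · by_cases h6 : f i = 1
      · left; rw [h6]; norm_num
      · right; have : 2 ≤ f i := by omega
        nlinarith
  refine ⟨i, hi, ?_, ?_⟩ <;> omega

theorem zero_of_sum {n : ℕ} (T : Finset (Fin n)) (f : Fin n → ℤ)
    (h : ∑ i ∈ T, f i ^ 2 = 0) : ∀ i ∈ T, f i = 0 := by
  intro i hi
  have := (Finset.sum_eq_zero_iff_of_nonneg (fun j _ => sq_nonneg (f j))).1 h i hi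
  exact pow_eq_zero_iff (two_ne_zero) |>.1 this

theorem val_cons {n : ℕ} (T : Finset (Fin n)) (i : Fin n) (hi : i ∈ T) :
    T.val = i ::ₘ (T.erase i).val := by
  rw [Finset.erase_val, Multiset.cons_erase (by simpa using hi)]

theorem sum_pick {n : ℕ} (T : Finset (Fin n)) (i : Fin n) (hi : i ∈ T) (f : Fin n → ℤ) :
    ∑ j ∈ T, f j = f i + ∑ j ∈ T.erase i, f j := (Finset.add_sum_erase T f hi).symm

theorem two_elts (a1 b1 d1 a2 b2 d2 R : ℤ) (hR : 0 ≤ R) (hd1 : d1 ^ 2 = 1) (hd2 : d2 ^ 2 = 1)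
    (h1 : 2 * a1 ^ 2 + 3 * (2 * b1 + d1) ^ 2 + (2 * a2 ^ 2 + 3 * (2 * b2 + d2) ^ 2 + R) = 28)
    (h3 : (2 * b1 + d1) * d1 + (2 * b2 + d2) * d2 = 2) : b1 = 0 ∧ b2 = 0 := by
  have e1 : d1 = 1 ∨ d1 = -1 := sq_eq_sq_iff_eq_or_eq_neg.1 (hd1.trans (one_pow 2).symm)
  have e2 : d2 = 1 ∨ d2 = -1 := sq_eq_sq_iff_eq_or_eq_neg.1 (hd2.trans (one_pow 2).symm)
  have h4 : (2 * b1 + d1) ^ 2 + (2 * b2 + d2) ^ 2 ≤ 9 := by nlinarith [sq_nonneg a1, sq_nonneg a2]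
  rcases e1 with rfl | rfl <;> rcases e2 with rfl | rfl
  · have : b2 = - b1 := by linarith
    subst this
    have : b1 ≤ 0 := by nlinarith
    have : 0 ≤ b1 := by nlinarith
    omega
  · have : b2 = b1 := by linarith
    subst this
    have : b2 ≤ 0 := by nlinarith
    have : 0 ≤ b2 := by nlinarith
    omega
  · have : b2 = b1 := by linarith
    subst this
    have : b2 ≤ 0 := by nlinarith
    have : 0 ≤ b2 := by nlinarith
    omega
  · have : b2 = - b1 := by linarith
    subst this
    have : b1 ≤ 0 := by nlinarith
    have : 0 ≤ b1 := by nlinarith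
    omega

theorem two_elts_a (a1 d1 a2 d2 : ℤ) (hd1 : d1 ^ 2 = 1) (hd2 : d2 ^ 2 = 1)
    (h1 : a1 ^ 2 + a2 ^ 2 ≤ 4) (h3 : a1 * d1 + a2 * d2 = 1) :
    (a1 = d1 ∧ a2 = 0) ∨ (a1 = 0 ∧ a2 = d2) := by
  have e1 : d1 = 1 ∨ d1 = -1 := sq_eq_sq_iff_eq_or_eq_neg.1 (hd1.trans (one_pow 2).symm)
  have e2 : d2 = 1 ∨ d2 = -1 := sq_eq_sq_iff_eq_or_eq_neg.1 (hd2.trans (one_pow 2).symm)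
  have u1 : a1 ≤ 2 := by nlinarith
  have u2 : -2 ≤ a1 := by nlinarith
  rcases e1 with rfl | rfl <;> rcases e2 with rfl | rfl
  · obtain rfl : a2 = 1 - a1 := by linarith
    interval_cases a1 <;> simp_all
  · obtain rfl : a2 = a1 - 1 := by linarith
    interval_cases a1 <;> simp_all
  · obtain rfl : a2 = 1 + a1 := by linarith
    interval_cases a1 <;> simp_all
  · obtain rfl : a2 = -1 - a1 := by linarith
    interval_cases a1 <;> simp_all

theorem comb_main {n : ℕ} (s : ℤ) (hs : 15 ≤ s) (a b c d : Fin n → ℤ)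
    (h1 : ∑ i, (2 * a i ^ 2 + 3 * (2 * b i + d i) ^ 2 + 2 * s * c i ^ 2 + 3 * s * d i ^ 2)
      = 28 + 6 * s)
    (h2 : ∑ i, (a i * (2 * b i + d i) + s * (c i * d i)) = 3)
    (h3 : ∑ i, (2 * (a i * c i) + 3 * ((2 * b i + d i) * d i)) = 6)
    (h4 : ∑ i, (a i * d i + (2 * b i + d i) * c i) = 1) :
    ∃ i1 i2 i3 i4 i5 i6 : Fin n, ∃ T : Finset (Fin n),
      (Finset.univ : Finset (Fin n)).val
        = i1 ::ₘ i2 ::ₘ i3 ::ₘ i4 ::ₘ i5 ::ₘ i6 ::ₘ T.val ∧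
      (∀ i, c i = 0) ∧
      (d i1 ^ 2 = 1 ∧ b i1 = 0 ∧ a i1 = d i1) ∧
      (d i2 ^ 2 = 1 ∧ b i2 = 0 ∧ a i2 = 0) ∧
      (d i3 = 0 ∧ b i3 = a i3 ∧ a i3 ^ 2 = 1) ∧
      (d i4 = 0 ∧ b i4 = 0 ∧ a i4 ^ 2 = 1) ∧
      (d i5 = 0 ∧ b i5 = 0 ∧ a i5 ^ 2 = 1) ∧
      (d i6 = 0 ∧ b i6 = 0 ∧ a i6 ^ 2 = 1) ∧
      (∀ i ∈ T, d i = 0 ∧ b i = 0 ∧ a i = 0) := by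
  -- bound on the sums of squares of `c` and `d`
  have hC0 : 0 ≤ ∑ i, c i ^ 2 := Finset.sum_nonneg fun j _ => sq_nonneg _
  have hD0 : 0 ≤ ∑ i, d i ^ 2 := Finset.sum_nonneg fun j _ => sq_nonneg _
  have hAB0 : 0 ≤ ∑ i, (2 * a i ^ 2 + 3 * (2 * b i + d i) ^ 2) :=
    Finset.sum_nonneg fun j _ => by positivity
  have hsplit : ∑ i, (2 * a i ^ 2 + 3 * (2 * b i + d i) ^ 2)
      + s * (2 * ∑ i, c i ^ 2 + 3 * ∑ i, d i ^ 2) = 28 + 6 * s := by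
    rw [← h1, mul_add, ← mul_assoc, ← mul_assoc, Finset.mul_sum, Finset.mul_sum,
      ← Finset.sum_add_distrib, ← Finset.sum_add_distrib]
    exact Finset.sum_congr rfl fun i _ => by ring
  have hCD : 2 * ∑ i, c i ^ 2 + 3 * ∑ i, d i ^ 2 ≤ 7 := by nlinarith
  -- parity
  have hDpar : (2 : ℤ) ∣ ∑ i, d i ^ 2 := by
    have : ∑ i, d i ^ 2 = 6 - 2 * ∑ i, (a i * c i + 3 * (b i * d i) + d i ^ 2) := by
      rw [← h3, Finset.mul_sum, ← Finset.sum_sub_distrib]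
      exact Finset.sum_congr rfl fun i _ => by ring
    rw [this]
    omega
  have hDne : ∑ i, d i ^ 2 ≠ 0 := by
    intro h0
    have hd := zero_of_sum _ _ h0
    have : ∑ i, (a i * d i + (2 * b i + d i) * c i) = 2 * ∑ i, b i * c i := by
      rw [Finset.mul_sum]
      exact Finset.sum_congr rfl fun i hi => by rw [hd i hi]; ring
    omega
  have hD : ∑ i, d i ^ 2 = 1 + 1 := by omega
  have hc' : ∑ i, c i ^ 2 = 0 := by omega
  have hc : ∀ i, c i = 0 := fun i => zero_of_sum _ _ hc' i (Finset.mem_univ i)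
  rw [hD, hc'] at hsplit
  have hsum : ∑ i, (2 * a i ^ 2 + 3 * (2 * b i + d i) ^ 2) = 28 := by linarith
  simp only [hc, mul_zero, zero_mul, add_zero, zero_add] at h2 h3 h4
  obtain ⟨i1, hi1, hd1, hD1⟩ := pick_one _ _ 1 (by norm_num) (by norm_num) hD
  obtain ⟨i2, hi2, hd2, hD2⟩ := pick_one _ _ 0 (by norm_num) (by norm_num)
    (hD1.trans (zero_add 1).symm)
  have hdz := zero_of_sum _ _ hD2
  rw [← Finset.mul_sum] at h3
  rw [sum_pick _ i1 hi1, sum_pick _ i2 hi2] at hsum h2 h3 h4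
  have hv1 := val_cons _ i1 hi1
  have hv2 := val_cons _ i2 hi2
  generalize (Finset.univ.erase i1).erase i2 = T2 at *
  have e3 : ∑ i ∈ T2, (2 * b i + d i) * d i = 0 :=
    Finset.sum_eq_zero fun i hi => by rw [hdz i hi]; ring
  have e4 : ∑ i ∈ T2, a i * d i = 0 :=
    Finset.sum_eq_zero fun i hi => by rw [hdz i hi]; ring
  have e2 : ∑ i ∈ T2, a i * (2 * b i + d i) = 2 * ∑ i ∈ T2, a i * b i := by
    rw [Finset.mul_sum]
    exact Finset.sum_congr rfl fun i hi => by rw [hdz i hi]; ring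
  have e1 : ∑ i ∈ T2, (2 * a i ^ 2 + 3 * (2 * b i + d i) ^ 2)
      = 2 * ∑ i ∈ T2, a i ^ 2 + 12 * ∑ i ∈ T2, b i ^ 2 := by
    rw [Finset.mul_sum, Finset.mul_sum, ← Finset.sum_add_distrib]
    exact Finset.sum_congr rfl fun i hi => by rw [hdz i hi]; ring
  rw [e3] at h3
  rw [e4] at h4
  rw [e2] at h2
  rw [e1] at hsum
  have hA0 : 0 ≤ ∑ i ∈ T2, a i ^ 2 := Finset.sum_nonneg fun j _ => sq_nonneg _
  have hB0 : 0 ≤ ∑ i ∈ T2, b i ^ 2 := Finset.sum_nonneg fun j _ => sq_nonneg _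
  obtain ⟨hb1, hb2⟩ := two_elts _ _ _ _ _ _ _ (by positivity) hd1 hd2 hsum (by linarith)
  rw [hb1, hb2] at h2 hsum
  simp only [mul_zero, zero_add, hd1, hd2, add_zero] at h2 h4 hsum
  have hab : ∑ i ∈ T2, a i * b i = 1 := by linarith
  have hBne : ∑ i ∈ T2, b i ^ 2 ≠ 0 := by
    intro h0
    have hb := zero_of_sum _ _ h0
    rw [Finset.sum_eq_zero fun i hi => by rw [hb i hi]; ring] at hab
    omega
  have hB : ∑ i ∈ T2, b i ^ 2 = 0 + 1 := by
    have := sq_nonneg (a i1)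
    have := sq_nonneg (a i2)
    omega
  obtain ⟨i3, hi3, hb3, hB3⟩ := pick_one _ _ 0 (by norm_num) (by norm_num) hB
  have hbz := zero_of_sum _ _ hB3
  have hd3 := hdz i3 hi3
  rw [hB, sum_pick _ i3 hi3 (fun i => a i ^ 2)] at hsum
  rw [sum_pick _ i3 hi3] at hab
  have hv3 := val_cons _ i3 hi3
  replace hdz := fun i (hi : i ∈ T2.erase i3) => hdz i (Finset.mem_of_mem_erase hi)
  generalize T2.erase i3 = T3 at *
  rw [Finset.sum_eq_zero fun i hi => by rw [hbz i hi]; ring] at hab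
  have ha3 : b i3 = a i3 := by
    linear_combination a i3 * hb3 - b i3 * hab
  have ha3' : a i3 ^ 2 = 1 := by rw [← ha3]; exact hb3
  rw [ha3'] at hsum
  have hA3 : 0 ≤ ∑ i ∈ T3, a i ^ 2 := Finset.sum_nonneg fun j _ => sq_nonneg _
  have key := two_elts_a _ _ _ _ hd1 hd2 (by linarith) h4
  have hA : ∑ i ∈ T3, a i ^ 2 = 2 + 1 := by
    rcases key with ⟨h, h'⟩ | ⟨h, h'⟩
    · rw [h, h', hd1] at hsum; omega
    · rw [h, h', hd2] at hsum; omega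
  obtain ⟨i4, hi4, ha4, hA4⟩ := pick_one _ _ 2 (by norm_num) (by norm_num) hA
  obtain ⟨i5, hi5, ha5, hA5⟩ := pick_one _ _ 1 (by norm_num) (by norm_num) hA4
  obtain ⟨i6, hi6, ha6, hA6⟩ := pick_one _ _ 0 (by norm_num) (by norm_num)
    (hA5.trans (zero_add 1).symm)
  have haz := zero_of_sum _ _ hA6
  have hv4 := val_cons _ i4 hi4
  have hv5 := val_cons _ i5 hi5
  have hv6 := val_cons _ i6 hi6
  have m5 := Finset.mem_of_mem_erase hi5
  have m6 := Finset.mem_of_mem_erase (Finset.mem_of_mem_erase hi6)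
  have hrest : ∀ i ∈ ((T3.erase i4).erase i5).erase i6, d i = 0 ∧ b i = 0 ∧ a i = 0 := by
    intro i hi
    have m := Finset.mem_of_mem_erase (Finset.mem_of_mem_erase (Finset.mem_of_mem_erase hi))
    exact ⟨hdz i m, hbz i m, haz i hi⟩
  have hval : (Finset.univ : Finset (Fin n)).val
      = i1 ::ₘ i2 ::ₘ i3 ::ₘ i4 ::ₘ i5 ::ₘ i6 ::ₘ (((T3.erase i4).erase i5).erase i6).val := by
    rw [hv1, hv2, hv3, hv4, hv5, hv6]
  have r3 : d i3 = 0 ∧ b i3 = a i3 ∧ a i3 ^ 2 = 1 := ⟨hd3, ha3, ha3'⟩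
  have r4 : d i4 = 0 ∧ b i4 = 0 ∧ a i4 ^ 2 = 1 := ⟨hdz _ hi4, hbz _ hi4, ha4⟩
  have r5 : d i5 = 0 ∧ b i5 = 0 ∧ a i5 ^ 2 = 1 := ⟨hdz _ m5, hbz _ m5, ha5⟩
  have r6 : d i6 = 0 ∧ b i6 = 0 ∧ a i6 ^ 2 = 1 := ⟨hdz _ m6, hbz _ m6, ha6⟩
  rcases key with ⟨h, h'⟩ | ⟨h, h'⟩
  · exact ⟨i1, i2, i3, i4, i5, i6, _, hval, hc, ⟨hd1, hb1, h⟩, ⟨hd2, hb2, h'⟩,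
      r3, r4, r5, r6, hrest⟩
  · exact ⟨i2, i1, i3, i4, i5, i6, _, hval.trans (Multiset.cons_swap _ _ _), hc,
      ⟨hd2, hb2, h'⟩, ⟨hd1, hb1, h⟩, r3, r4, r5, r6, hrest⟩

open QuadraticAlgebra in
theorem quad_integral {F : Type*} [Field F] [CharZero F] (a : F) (z : QuadraticAlgebra F a 0)
    (hz : IsIntegral ℤ z) :
    IsIntegral ℤ (z.re + z.re) ∧ IsIntegral ℤ (z.re ^ 2 - a * z.im ^ 2) := by
  have hinj : Function.Injective (algebraMap F (QuadraticAlgebra F a 0)) :=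
    algebraMap_injective
  have hs : IsIntegral ℤ (star z) :=
    map_isIntegral_int (starRingEnd (QuadraticAlgebra F a 0)) hz
  have e1 : algebraMap F (QuadraticAlgebra F a 0) (z.re + z.re) = z + star z := by
    ext <;> simp
  have e2 : algebraMap F (QuadraticAlgebra F a 0) (z.re ^ 2 - a * z.im ^ 2) = z * star z := by
    rw [QuadraticAlgebra.algebraMap_eq]
    ext <;> simp <;> ring
  constructor
  · have := hz.add hs
    rw [← e1] at this
    exact (isIntegral_algHom_iff (algebraMap F (QuadraticAlgebra F a 0)).toIntAlgHom hinj).1 this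
  · have := hz.mul hs
    rw [← e2] at this
    exact (isIntegral_algHom_iff (algebraMap F (QuadraticAlgebra F a 0)).toIntAlgHom hinj).1 this

theorem rat_int (q : ℚ) (h : IsIntegral ℤ q) : ∃ m : ℤ, q = m := by
  obtain ⟨m, hm⟩ := IsIntegrallyClosed.isIntegral_iff.1 h
  exact ⟨m, by simpa using hm.symm⟩

/-- The field `ℚ(√6)`. -/
abbrev KOne : Type := QuadraticAlgebra ℚ 6 0

theorem six_sq_dvd (q : ℚ) (N : ℤ) (h : 6 * q ^ 2 = N) : ∃ m : ℤ, q = m := by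
  have h1 : IsIntegral ℤ (6 * q) := by
    refine IsIntegral.of_pow (n := 2) (by norm_num) ?_
    have : (6 * q) ^ 2 = ((6 * N : ℤ) : ℚ) := by push_cast; rw [← h]; ring
    rw [this]; exact isIntegral_algebraMap (R := ℤ) (A := ℚ) (x := 6 * N)
  obtain ⟨k, hk⟩ := rat_int _ h1
  have h2 : k ^ 2 = 6 * N := by
    have : ((k ^ 2 : ℤ) : ℚ) = ((6 * N : ℤ) : ℚ) := by push_cast; rw [← h, ← hk]; ring
    exact_mod_cast this
  have h3 : (6 : ℤ) ∣ k := by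
    have h4 : (6 : ℤ) ∣ k ^ 2 := ⟨N, h2⟩
    have h5 : (2 : ℤ) ∣ k := Int.prime_two.dvd_of_dvd_pow (n := 2) (by omega)
    have h6 : (3 : ℤ) ∣ k := Int.prime_three.dvd_of_dvd_pow (n := 2) (by omega)
    omega
  obtain ⟨m, rfl⟩ := h3
  refine ⟨m, ?_⟩
  push_cast at hk
  linarith

theorem kone_integral (z : KOne) (hz : IsIntegral ℤ z) : ∃ m n : ℤ, z.re = m ∧ z.im = n := by
  obtain ⟨h1, h2⟩ := quad_integral _ z hz
  rw [← two_mul] at h1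
  obtain ⟨m, hm⟩ := rat_int _ h1
  obtain ⟨N, hN⟩ := rat_int _ h2
  obtain ⟨n, hn⟩ := six_sq_dvd (2 * z.im) (m ^ 2 - 4 * N) (by push_cast; rw [← hm, ← hN]; ring)
  have h3 : m ^ 2 - 6 * n ^ 2 = 4 * N := by
    have : ((m ^ 2 - 6 * n ^ 2 : ℤ) : ℚ) = ((4 * N : ℤ) : ℚ) := by
      push_cast; rw [← hm, ← hN, ← hn]; ring
    exact_mod_cast this
  have hm2 : (2 : ℤ) ∣ m := Int.prime_two.dvd_of_dvd_pow (n := 2) (by omega)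
  obtain ⟨m', rfl⟩ := hm2
  have hn2 : (2 : ℤ) ∣ n := Int.prime_two.dvd_of_dvd_pow (n := 2) (by
    have : (2 * m') ^ 2 = 4 * m' ^ 2 := by ring
    omega)
  obtain ⟨n', rfl⟩ := hn2
  refine ⟨m', n', ?_, ?_⟩
  · push_cast at hm; linarith
  · push_cast at hn; linarith

theorem rat_sq_ne (N : ℕ) (p : ℕ) (hp : p.Prime) (h1 : p ∣ N) (h2 : ¬ p ^ 2 ∣ N) (q : ℚ) :
    q ^ 2 ≠ N := by
  intro h
  have hi : IsIntegral ℤ q := by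
    refine IsIntegral.of_pow (n := 2) (by norm_num) ?_
    rw [h]; exact isIntegral_algebraMap (R := ℤ) (A := ℚ) (x := (N : ℤ))
  obtain ⟨k, rfl⟩ := rat_int _ hi
  have h3 : k ^ 2 = N := by exact_mod_cast h
  have h4 : k.natAbs ^ 2 = N := by
    zify; rw [sq_abs]; exact h3
  have h5 : p ∣ k.natAbs := hp.dvd_of_dvd_pow (n := 2) (h4 ▸ h1)
  exact h2 (h4 ▸ pow_dvd_pow_of_dvd h5 2)

instance factOne : Fact (∀ r : ℚ, r ^ 2 ≠ 6 + 0 * r) := ⟨fun r => by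
  have := rat_sq_ne 6 2 Nat.prime_two (by norm_num) (by norm_num) r
  simpa using this⟩

theorem nat_sq_ne (s : ℕ) (hs4 : s % 4 = 3) (q : ℚ) : q ^ 2 ≠ s := by
  intro h
  have hi : IsIntegral ℤ q := by
    refine IsIntegral.of_pow (n := 2) (by norm_num) ?_
    rw [h]; exact isIntegral_algebraMap (R := ℤ) (A := ℚ) (x := (s : ℤ))
  obtain ⟨k, rfl⟩ := rat_int _ hi
  have h3 : k ^ 2 = s := by exact_mod_cast h
  rcases Int.even_or_odd' k with ⟨m, rfl | rfl⟩ <;> ring_nf at h3 <;> omega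

theorem factTwo (s : ℕ) (hs4 : s % 4 = 3) (_h3 : ¬ 3 ∣ s) :
    ∀ r : KOne, r ^ 2 ≠ (s : KOne) + 0 * r := by
  intro r h
  rw [zero_mul, add_zero, sq] at h
  have hre := congrArg QuadraticAlgebra.re h
  have him := congrArg QuadraticAlgebra.im h
  simp at hre him
  have : r.re * r.im = 0 := by linarith
  rcases mul_eq_zero.1 this with h0 | h0
  · rw [h0] at hre
    obtain ⟨m, hm⟩ := six_sq_dvd r.im s (by push_cast; linarith)
    rw [hm] at hre
    have : 0 * 0 + 6 * m * m = (s : ℤ) := by exact_mod_cast hre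
    rw [mul_assoc] at this
    omega
  · rw [h0] at hre
    exact nat_sq_ne s hs4 r.re (by rw [← hre]; ring)

/-- The field `ℚ(√6, √s)`. -/
abbrev KTwo (s : ℕ) : Type := QuadraticAlgebra KOne (s : KOne) 0

theorem s_dvd (s : ℤ) (hsf : Squarefree s) (hc : IsCoprime s 6) (u v : ℤ)
    (h1 : s ∣ u ^ 2 + 6 * v ^ 2) (h2 : s ∣ 2 * (u * v)) : s ∣ u ∧ s ∣ v := by
  have h6 : s ∣ u * v := by
    have : s ∣ 6 * (u * v) := by
      have := h2.mul_left 3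
      rwa [← mul_assoc] at this
    exact hc.dvd_of_dvd_mul_left this
  constructor
  · have : s ∣ u ^ 4 := by
      have e : u ^ 4 = u ^ 2 * (u ^ 2 + 6 * v ^ 2) - (u * v) * (6 * u * v) := by ring
      rw [e]; exact dvd_sub (h1.mul_left _) (h6.mul_right _)
    exact (hsf.dvd_pow_iff_dvd (by norm_num)).1 this
  · have : s ∣ 6 * v ^ 4 := by
      have e : 6 * v ^ 4 = v ^ 2 * (u ^ 2 + 6 * v ^ 2) - (u * v) * (u * v) := by ring
      rw [e]; exact dvd_sub (h1.mul_left _) (h6.mul_right _)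
    exact (hsf.dvd_pow_iff_dvd (by norm_num)).1 (hc.dvd_of_dvd_mul_left this)

theorem parity (s A B C D M N : ℤ) (hs4 : s % 4 = 3)
    (h1 : A ^ 2 + 6 * B ^ 2 - s * (C ^ 2 + 6 * D ^ 2) = 4 * M)
    (h2 : A * B - s * (C * D) = 2 * N) :
    ∃ a b c d : ℤ, A = 2 * a ∧ B = 2 * b + d ∧ C = 2 * c ∧ D = d := by
  obtain ⟨k, rfl⟩ : ∃ k, s = 4 * k + 3 := ⟨s / 4, by omega⟩
  obtain ⟨A', hA⟩ := Int.even_or_odd' A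
  obtain ⟨B', hB⟩ := Int.even_or_odd' B
  obtain ⟨C', hC⟩ := Int.even_or_odd' C
  obtain ⟨D', hD⟩ := Int.even_or_odd' D
  rcases hA with rfl | rfl <;> rcases hB with rfl | rfl <;> rcases hC with rfl | rfl <;>
    rcases hD with rfl | rfl <;> ring_nf at h1 h2 <;>
    first
    | (exfalso; omega)
    | exact ⟨A', B' - D', C', 2 * D', rfl, by ring1, rfl, rfl⟩
    | exact ⟨A', B' - D', C', 2 * D' + 1, rfl, by ring1, rfl, rfl⟩

theorem ktwo_integral (s : ℕ) (hs4 : s % 4 = 3) (hsf : Squarefree s) (h3 : ¬ 3 ∣ s)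
    (hs0 : 0 < s) (z : KTwo s) (hz : IsIntegral ℤ z) :
    ∃ a b c d : ℤ, z = ⟨⟨a, (2 * b + d) / 2⟩, ⟨c, d / 2⟩⟩ := by
  have : Fact (∀ r : KOne, r ^ 2 ≠ (s : KOne) + 0 * r) := ⟨factTwo s hs4 h3⟩
  have hsi : IsIntegral ℤ (⟨0, 1⟩ : KTwo s) := by
    refine IsIntegral.of_pow (n := 2) (by norm_num) ?_
    have : (⟨0, 1⟩ : KTwo s) ^ 2 = ((s : ℤ) : KTwo s) := by
      rw [sq]; ext <;> simp
    rw [this]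
    exact isIntegral_algebraMap (R := ℤ) (A := KTwo s) (x := (s : ℤ))
  obtain ⟨t1, n1⟩ := quad_integral _ z hz
  obtain ⟨t2, -⟩ := quad_integral _ _ (hz.mul hsi)
  obtain ⟨A, B, hA, hB⟩ := kone_integral _ t1
  obtain ⟨U, V, hU, hV⟩ := kone_integral _ t2
  obtain ⟨M, N, hM, hN⟩ := kone_integral _ n1
  obtain ⟨⟨p, q⟩, ⟨r, t⟩⟩ := z
  simp [sq] at hA hB hU hV hM hN
  rw [← two_mul] at hA hB
  have hs' : (s : ℚ) ≠ 0 := by positivity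
  have hU' : U = 2 * s * r := by rw [← hU]; ring
  have hV' : V = 2 * s * t := by rw [← hV]; ring
  have hc : IsCoprime (s : ℤ) 6 := by
    have : Nat.Coprime s 6 := by
      rw [show (6 : ℕ) = 2 * 3 by norm_num]
      refine Nat.Coprime.mul_right ?_ ?_
      · exact (Nat.Coprime.symm ((Nat.Prime.coprime_iff_not_dvd Nat.prime_two).2 (by omega)))
      · exact (Nat.Coprime.symm ((Nat.Prime.coprime_iff_not_dvd Nat.prime_three).2 h3))
    exact_mod_cast this.isCoprime
  have k1 : U ^ 2 + 6 * V ^ 2 = s * (A ^ 2 + 6 * B ^ 2 - 4 * M) := by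
    have : ((U ^ 2 + 6 * V ^ 2 : ℤ) : ℚ) = ((s * (A ^ 2 + 6 * B ^ 2 - 4 * M) : ℤ) : ℚ) := by
      push_cast
      rw [hU', hV', ← hA, ← hB, ← hM]
      ring
    exact_mod_cast this
  have k2 : 2 * (U * V) = s * (2 * (A * B) - 4 * N) := by
    have : ((2 * (U * V) : ℤ) : ℚ) = ((s * (2 * (A * B) - 4 * N) : ℤ) : ℚ) := by
      push_cast
      rw [hU', hV', ← hA, ← hB, ← hN]
      ring
    exact_mod_cast this
  obtain ⟨⟨C, rfl⟩, ⟨D, rfl⟩⟩ := s_dvd s (by exact_mod_cast Int.squarefree_natCast.2 hsf) hc U V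
    ⟨_, k1⟩ ⟨_, k2⟩
  have hC : (C : ℚ) = 2 * r := by
    have : (s : ℚ) * C = s * (2 * r) := by push_cast at hU'; linarith
    exact mul_left_cancel₀ hs' this
  have hD : (D : ℚ) = 2 * t := by
    have : (s : ℚ) * D = s * (2 * t) := by push_cast at hV'; linarith
    exact mul_left_cancel₀ hs' this
  have p1 : A ^ 2 + 6 * B ^ 2 - s * (C ^ 2 + 6 * D ^ 2) = 4 * M := by
    have : ((A ^ 2 + 6 * B ^ 2 - s * (C ^ 2 + 6 * D ^ 2) : ℤ) : ℚ) = ((4 * M : ℤ) : ℚ) := by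
      push_cast
      rw [hC, hD, ← hA, ← hB, ← hM]
      ring
    exact_mod_cast this
  have p2 : A * B - s * (C * D) = 2 * N := by
    have : ((A * B - s * (C * D) : ℤ) : ℚ) = ((2 * N : ℤ) : ℚ) := by
      push_cast
      rw [hC, hD, ← hA, ← hB, ← hN]
      ring
    exact_mod_cast this
  obtain ⟨a, b, c, d, rfl, rfl, rfl, rfl⟩ := parity s A B C D M N (by omega) p1 p2
  refine ⟨a, b, c, D, ?_⟩
  push_cast at hA hB hC
  ext <;> simp only <;> linarith

/-- The embedding of `ℚ(√6, √s)` into the reals. -/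
noncomputable def phi (s : ℕ) : KTwo s →+* ℝ where
  toFun z := z.re.re + z.re.im * √6 + z.im.re * √s + z.im.im * (√6 * √s)
  map_one' := by simp [QuadraticAlgebra.re_one, QuadraticAlgebra.im_one]
  map_zero' := by simp
  map_add' x y := by simp; ring
  map_mul' x y := by
    have h6 : √6 * √6 = (6 : ℝ) := Real.mul_self_sqrt (by norm_num)
    have hs : √(s : ℝ) * √s = s := Real.mul_self_sqrt (by positivity)
    simp
    generalize √6 = p at *
    generalize √(s : ℝ) = q at *
    rw [← h6, ← hs]
    ring

theorem phi_apply (s : ℕ) (z : KTwo s) :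
    phi s z = z.re.re + z.re.im * √6 + z.im.re * √s + z.im.im * (√6 * √s) := rfl

theorem phi_inj (s : ℕ) (hs4 : s % 4 = 3) (h3 : ¬ 3 ∣ s) : Function.Injective (phi s) := by
  have : Fact (∀ r : KOne, r ^ 2 ≠ (s : KOne) + 0 * r) := ⟨factTwo s hs4 h3⟩
  exact (phi s).injective

theorem lin_indep (s : ℕ) (hs4 : s % 4 = 3) (h3 : ¬ 3 ∣ s) (p q r t p' q' r' t' : ℤ)
    (h : (p : ℝ) + q * √6 + r * √s + t * (√6 * √s)
      = p' + q' * √6 + r' * √s + t' * (√6 * √s)) : p = p' ∧ q = q' ∧ r = r' ∧ t = t' := by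
  have := @phi_inj s hs4 h3 ⟨⟨p, q⟩, ⟨r, t⟩⟩ ⟨⟨p', q'⟩, ⟨r', t'⟩⟩ (by
    rw [phi_apply, phi_apply]; simpa using h)
  simpa [QuadraticAlgebra.ext_iff, and_assoc] using this

theorem mem_form (s : ℕ) (hs4 : s % 4 = 3) (hsf : Squarefree s) (h3 : ¬ 3 ∣ s) (hs0 : 0 < s)
    (x : ℝ) (hx : x ∈ ringOfInt 6 (s : ℝ)) :
    ∃ a b c d : ℤ, x = a + (2 * b + d) / 2 * √6 + c * √s + d / 2 * (√6 * √s) := by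
  have hf : Fact (∀ r : KOne, r ^ 2 ≠ (s : KOne) + 0 * r) := ⟨factTwo s hs4 h3⟩
  obtain ⟨hx1, hx2⟩ := hx
  have hle : biquadField 6 (s : ℝ) ≤ (phi s).toRatAlgHom.fieldRange := by
    rw [biquadField, IntermediateField.adjoin_le_iff]
    rintro y (rfl | rfl)
    · refine ⟨⟨⟨0, 1⟩, ⟨0, 0⟩⟩, ?_⟩
      change phi s _ = _
      simp [phi_apply]
    · refine ⟨⟨⟨0, 0⟩, ⟨1, 0⟩⟩, ?_⟩
      change phi s _ = _
      simp [phi_apply]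
  obtain ⟨z, hz⟩ := hle hx1
  change phi s z = x at hz
  subst hz
  have hzi : IsIntegral ℤ z :=
    (isIntegral_algHom_iff (phi s).toIntAlgHom (phi s).injective).1 hx2
  obtain ⟨a, b, c, d, rfl⟩ := ktwo_integral s hs4 hsf h3 hs0 z hzi
  refine ⟨a, b, c, d, ?_⟩
  rw [phi_apply]
  push_cast
  ring

theorem cast_nat_int_integral (k : ℕ) : IsIntegral ℤ (k : ℝ) :=
  isIntegral_algebraMap (R := ℤ) (A := ℝ) (x := (k : ℤ))

theorem sqrt_integral (k : ℕ) : IsIntegral ℤ (√(k : ℝ)) := by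
  refine IsIntegral.of_pow (n := 2) (by norm_num) ?_
  rw [Real.sq_sqrt (by positivity)]
  exact cast_nat_int_integral k

theorem sqrt_six_mul (s : ℕ) : √(6 * (s : ℝ)) = √6 * √s := Real.sqrt_mul (by norm_num) _

theorem six_mem (s : ℕ) (hs4 : s % 4 = 3) :
    (1 : ℝ) ∈ ringOfInt 6 (s : ℝ) ∧ (1 + √6) ∈ ringOfInt 6 (s : ℝ) ∧
    (√6 + √(6 * s)) / 2 ∈ ringOfInt 6 (s : ℝ) ∧
    1 + (√6 + √(6 * s)) / 2 ∈ ringOfInt 6 (s : ℝ) := by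
  have m6 : √6 ∈ biquadField 6 (s : ℝ) := IntermediateField.subset_adjoin _ _ (by simp)
  have ms : √s ∈ biquadField 6 (s : ℝ) := IntermediateField.subset_adjoin _ _ (by simp)
  have i6 : IsIntegral ℤ √6 := by simpa using sqrt_integral 6
  have m1 : (√6 + √(6 * s)) / 2 ∈ biquadField 6 (s : ℝ) := by
    rw [sqrt_six_mul]
    exact div_mem (add_mem m6 (mul_mem m6 ms)) (ofNat_mem _ 2)
  have i1 : IsIntegral ℤ ((√6 + √(6 * s)) / 2) := by
    refine IsIntegral.of_pow (n := 2) (by norm_num) ?_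
    have h6 : √6 * √6 = (6 : ℝ) := Real.mul_self_sqrt (by norm_num)
    have hs : √(s : ℝ) * √s = s := Real.mul_self_sqrt (by positivity)
    obtain ⟨k, hk⟩ : ∃ k, s = 2 * k + 1 := ⟨s / 2, by omega⟩
    have hk' : (s : ℝ) = 2 * k + 1 := by rw [hk]; push_cast; ring
    have e : ((√6 + √(6 * s)) / 2) ^ 2 = ((3 * k + 3 : ℕ) : ℝ) + ((3 : ℕ) : ℝ) * √s := by
      rw [sqrt_six_mul]
      push_cast
      linear_combination (1 + 2 * √s + √s * √s) / 4 * h6 + 6 / 4 * hs + 6 / 4 * hk'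
    rw [e]
    exact (cast_nat_int_integral _).add ((cast_nat_int_integral _).mul (sqrt_integral s))
  exact ⟨⟨one_mem _, isIntegral_one⟩, ⟨add_mem (one_mem _) m6, isIntegral_one.add i6⟩,
    ⟨m1, i1⟩, ⟨add_mem (one_mem _) m1, isIntegral_one.add i1⟩⟩

theorem unique_rep (s : ℕ) (hs4 : s % 4 = 3) (hsf : Squarefree s)
    (hs19 : 19 ≤ s) (h3 : ¬ (3 ∣ s)) (n : ℕ) (x : Fin n → ℝ)
    (hx : ∀ i, x i ∈ ringOfInt 6 (s : ℝ))
    (h : (1 : ℝ) ^ 2 + 1 ^ 2 + 1 ^ 2 + (1 + Real.sqrt 6) ^ 2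
          + ((Real.sqrt 6 + Real.sqrt (6 * s)) / 2) ^ 2
          + (1 + (Real.sqrt 6 + Real.sqrt (6 * s)) / 2) ^ 2 = ∑ i, x i ^ 2) :
      ((Finset.univ.val.map fun i => x i ^ 2).filter fun r => r ≠ 0)
        = ({(1 + (Real.sqrt 6 + Real.sqrt (6 * s)) / 2) ^ 2,
            ((Real.sqrt 6 + Real.sqrt (6 * s)) / 2) ^ 2,
            (1 + Real.sqrt 6) ^ 2, 1, 1, 1} : Multiset ℝ) := by
  have h6 : √6 * √6 = (6 : ℝ) := Real.mul_self_sqrt (by norm_num)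
  have hs : √(s : ℝ) * √s = s := Real.mul_self_sqrt (by positivity)
  have p6 : 0 < √(6 : ℝ) := by positivity
  have ps : 0 ≤ √(s : ℝ) := by positivity
  choose a b c d hform using fun i => mem_form s hs4 hsf h3 (by omega) (x i) (hx i)
  rw [sqrt_six_mul] at h ⊢
  have hsq : ∀ i, 2 * x i ^ 2 =
      ((2 * a i ^ 2 + 3 * (2 * b i + d i) ^ 2 + 2 * s * c i ^ 2 + 3 * s * d i ^ 2 : ℤ) : ℝ)
      + ((2 * (a i * (2 * b i + d i) + s * (c i * d i)) : ℤ) : ℝ) * √6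
      + ((2 * (2 * (a i * c i) + 3 * ((2 * b i + d i) * d i)) : ℤ) : ℝ) * √s
      + ((2 * (a i * d i + (2 * b i + d i) * c i) : ℤ) : ℝ) * (√6 * √s) := by
    intro i
    rw [hform i]
    push_cast
    generalize √6 = p at *
    generalize √(s : ℝ) = q at *
    rw [← hs]
    linear_combination ((2 * b i + d i : ℝ) ^ 2 / 2 + (2 * b i + d i : ℝ) * d i * q
      + d i ^ 2 / 2 * q ^ 2 ) * h6
  have hsum : 2 * ∑ i, x i ^ 2 =
      ((∑ i, (2 * a i ^ 2 + 3 * (2 * b i + d i) ^ 2 + 2 * s * c i ^ 2 + 3 * s * d i ^ 2) : ℤ) : ℝ)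
      + ((2 * ∑ i, (a i * (2 * b i + d i) + s * (c i * d i)) : ℤ) : ℝ) * √6
      + ((2 * ∑ i, (2 * (a i * c i) + 3 * ((2 * b i + d i) * d i)) : ℤ) : ℝ) * √s
      + ((2 * ∑ i, (a i * d i + (2 * b i + d i) * c i) : ℤ) : ℝ) * (√6 * √s) := by
    simp only [Finset.mul_sum, Int.cast_sum]
    simp only [Finset.sum_mul, ← Finset.sum_add_distrib]
    exact Finset.sum_congr rfl fun i _ => hsq i
  have hlhs : 2 * ∑ i, x i ^ 2 = ((28 + 6 * s : ℤ) : ℝ) + ((6 : ℤ) : ℝ) * √6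
      + ((12 : ℤ) : ℝ) * √s + ((2 : ℤ) : ℝ) * (√6 * √s) := by
    rw [← h]
    push_cast
    generalize √6 = p at *
    generalize √(s : ℝ) = q at *
    rw [← hs]
    linear_combination (3 + q ^ 2 + 2 * q) * h6
  obtain ⟨g1, g2, g3, g4⟩ := lin_indep s hs4 h3 _ _ _ _ _ _ _ _ (hsum.symm.trans hlhs)
  obtain ⟨i1, i2, i3, i4, i5, i6, T, hv, hc, ⟨r1, r1', r1''⟩, ⟨r2, r2', r2''⟩, ⟨r3, r3', r3''⟩,
    ⟨r4, r4', r4''⟩, ⟨r5, r5', r5''⟩, ⟨r6, r6', r6''⟩, hT⟩ :=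
    comb_main (s : ℤ) (by omega) a b c d g1 (by linarith) (by linarith) (by linarith)
  have f1 : x i1 ^ 2 = (1 + (√6 + √6 * √s) / 2) ^ 2 := by
    have e : (d i1 : ℝ) ^ 2 = 1 := by exact_mod_cast r1
    rw [hform, r1', r1'', hc]
    push_cast
    linear_combination (1 + (√6 + √6 * √s) / 2) ^ 2 * e
  have f2 : x i2 ^ 2 = ((√6 + √6 * √s) / 2) ^ 2 := by
    have e : (d i2 : ℝ) ^ 2 = 1 := by exact_mod_cast r2
    rw [hform, r2', r2'', hc]
    push_cast
    linear_combination ((√6 + √6 * √s) / 2) ^ 2 * e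
  have f3 : x i3 ^ 2 = (1 + √6) ^ 2 := by
    have e : (a i3 : ℝ) ^ 2 = 1 := by exact_mod_cast r3''
    rw [hform, r3, r3', hc]
    push_cast
    linear_combination (1 + √6) ^ 2 * e
  have f4 : x i4 ^ 2 = 1 := by
    have e : (a i4 : ℝ) ^ 2 = 1 := by exact_mod_cast r4''
    rw [hform, r4, r4', hc, ← e]
    push_cast
    ring
  have f5 : x i5 ^ 2 = 1 := by
    have e : (a i5 : ℝ) ^ 2 = 1 := by exact_mod_cast r5''
    rw [hform, r5, r5', hc, ← e]
    push_cast
    ring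
  have f6 : x i6 ^ 2 = 1 := by
    have e : (a i6 : ℝ) ^ 2 = 1 := by exact_mod_cast r6''
    rw [hform, r6, r6', hc, ← e]
    push_cast
    ring
  have fT : (T.val.map fun i => x i ^ 2).filter (fun r => r ≠ 0) = 0 := by
    rw [Multiset.filter_eq_nil]
    intro r hr
    obtain ⟨i, hi, rfl⟩ := Multiset.mem_map.1 hr
    obtain ⟨q1, q2, q3⟩ := hT i (by simpa using hi)
    rw [hform, q1, q2, q3, hc]
    simp
  have n1 : (1 + (√6 + √6 * √s) / 2) ^ 2 ≠ 0 := by positivity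
  have n2 : ((√6 + √6 * √s) / 2) ^ 2 ≠ 0 := by positivity
  have n3 : (1 + √6) ^ 2 ≠ 0 := by positivity
  rw [hv]
  simp only [Multiset.map_cons, f1, f2, f3, f4, f5, f6]
  rw [Multiset.filter_cons_of_pos (p := fun r : ℝ => r ≠ 0) _ n1, Multiset.filter_cons_of_pos (p := fun r : ℝ => r ≠ 0) _ n2,
    Multiset.filter_cons_of_pos (p := fun r : ℝ => r ≠ 0) _ n3, Multiset.filter_cons_of_pos (p := fun r : ℝ => r ≠ 0) _ one_ne_zero,
    Multiset.filter_cons_of_pos (p := fun r : ℝ => r ≠ 0) _ one_ne_zero, Multiset.filter_cons_of_pos (p := fun r : ℝ => r ≠ 0) _ one_ne_zero, fT]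
  rfl


theorem m6_s3_length_six (s : ℕ) (hs4 : s % 4 = 3) (hsf : Squarefree s)
    (hs19 : 19 ≤ s) (h3 : ¬ (3 ∣ s)) :
    sqLength (ringOfInt 6 (s : ℝ))
        ((1 : ℝ) ^ 2 + 1 ^ 2 + 1 ^ 2 + (1 + Real.sqrt 6) ^ 2
          + ((Real.sqrt 6 + Real.sqrt (6 * s)) / 2) ^ 2
          + (1 + (Real.sqrt 6 + Real.sqrt (6 * s)) / 2) ^ 2) = 6 ∧
    (∀ (n : ℕ) (x : Fin n → ℝ), (∀ i, x i ∈ ringOfInt 6 (s : ℝ)) →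
      (1 : ℝ) ^ 2 + 1 ^ 2 + 1 ^ 2 + (1 + Real.sqrt 6) ^ 2
          + ((Real.sqrt 6 + Real.sqrt (6 * s)) / 2) ^ 2
          + (1 + (Real.sqrt 6 + Real.sqrt (6 * s)) / 2) ^ 2 = ∑ i, x i ^ 2 →
      ((Finset.univ.val.map fun i => x i ^ 2).filter fun r => r ≠ 0)
        = ({(1 + (Real.sqrt 6 + Real.sqrt (6 * s)) / 2) ^ 2,
            ((Real.sqrt 6 + Real.sqrt (6 * s)) / 2) ^ 2,
            (1 + Real.sqrt 6) ^ 2, 1, 1, 1} : Multiset ℝ)) := by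
  have huniq := unique_rep s hs4 hsf hs19 h3
  refine ⟨le_antisymm ?_ ?_, huniq⟩
  · obtain ⟨m1, m2, m3, m4⟩ := six_mem s hs4
    refine sInf_le ⟨6, rfl, ![1, 1, 1, 1 + √6, (√6 + √(6 * s)) / 2, 1 + (√6 + √(6 * s)) / 2],
      ?_, ?_⟩
    · intro i
      fin_cases i
      exacts [m1, m1, m1, m2, m3, m4]
    · simp [Fin.sum_univ_succ]
      ring
  · refine le_sInf ?_
    rintro _ ⟨k, rfl, x, hx, h⟩
    have hk := congrArg Multiset.card (huniq k x hx h)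
    have hle := Multiset.card_le_card
      (Multiset.filter_le (fun r : ℝ => r ≠ 0) (Finset.univ.val.map fun i => x i ^ 2))
    rw [hk] at hle
    simp at hle
    exact_mod_cast hle
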